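/- Let φ be a bounded self-adjoint linear functional on a C*-algebra A satisfying φ(a*a) = φ(aa*) for all a ∈ A. Then in its Jordan decomposition φ = φ₊ − φ₋ into positive functionals with ‖φ‖ = ‖φ₊‖ + ‖φ₋‖, both φ₊ and φ₋ are tracial (i.e., φ±(xy) = φ±(yx) for all x, y). -/

import Mathlib

open scoped ComplexOrder

section JordanDecomposition

open scoped ComplexStarModule

variable {A : Type*} [CStarAlgebra A]

/-- If `φ (a⋆ a) = φ (a a⋆)` for all `a`, then `φ` is tracial. -/
theorem ContinuousLinearMap.map_mul_comm_of_map_star_mul_self (φ : A →L[ℂ] ℂ)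
    (htr : ∀ a : A, φ (star a * a) = φ (a * star a)) (x y : A) : φ (x * y) = φ (y * x) := by
  have hx := htr (star x)
  have hy := htr y
  have h1 := htr (star x + y)
  have h2 := htr (star x + Complex.I • y)
  simp only [star_add, star_star, star_smul, mul_add, add_mul, map_add, smul_mul_assoc,
    mul_smul_comm, map_smul, smul_eq_mul, Complex.star_def, Complex.conj_I] at hx hy h1 h2
  linear_combination (1 / 2) * h1 - (Complex.I / 2) * h2 +
    (-1 / 2 + Complex.I / 2) * hx + (-1 / 2 + Complex.I / 2) * hy +
    ((φ (x * y) - φ (star y * star x) + φ (star x * star y) - φ (y * x)) / 2) * Complex.I_sq +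
    (Complex.I / 2) * (φ (y * star y) - φ (star y * y)) * Complex.I_sq

/-- The norm of a self-adjoint functional is approximated on self-adjoint contractions. -/
theorem ContinuousLinearMap.exists_isSelfAdjoint_lt_re_apply (φ : A →L[ℂ] ℂ)
    (hsa : ∀ a : A, φ (star a) = starRingEnd ℂ (φ a)) {r : ℝ} (hr : r < ‖φ‖) :
    ∃ a : A, IsSelfAdjoint a ∧ ‖a‖ ≤ 1 ∧ r < (φ a).re := by
  obtain ⟨x, hx, hrx⟩ := φ.exists_lt_apply_of_lt_opNorm hr
  obtain ⟨c, hc, hcx⟩ := RCLike.exists_norm_eq_mul_self (φ x)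
  refine ⟨ℜ (c • x), (ℜ (c • x)).2, ?_, ?_⟩
  · calc ‖(ℜ (c • x) : A)‖ ≤ ‖c • x‖ := by exact_mod_cast realPart.norm_le (c • x)
      _ ≤ 1 := by rw [norm_smul, hc, one_mul]; exact hx.le
  · have key : φ (ℜ (c • x) : A) = ‖φ x‖ := by
      rw [realPart_apply_coe, ← Complex.coe_smul, map_smul, map_add, hsa, map_smul, smul_eq_mul,
        smul_eq_mul, ← show ((‖φ x‖ : ℝ) : ℂ) = c * φ x from hcx, Complex.conj_ofReal]
      push_cast
      ring
    rwa [key, Complex.ofReal_re]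

variable [PartialOrder A] [StarOrderedRing A]

/-- The Cauchy–Schwarz inequality for positive functionals. -/
theorem ContinuousLinearMap.norm_sq_apply_star_mul_le (f : A →L[ℂ] ℂ)
    (hf : ∀ a : A, 0 ≤ a → 0 ≤ f a) (a b : A) :
    ‖f (star a * b)‖ ^ 2 ≤ (f (star a * a)).re * (f (star b * b)).re := by
  let g : A →ₚ[ℂ] ℂ := PositiveLinearMap.mk₀ (f : A →ₗ[ℂ] ℂ) hf
  have h := norm_inner_le_norm (𝕜 := ℂ) (g.toPreGNS a) (g.toPreGNS b)
  have h0 (c : A) : ‖g.toPreGNS c‖ ^ 2 = (f (star c * c)).re := by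
    exact_mod_cast congrArg Complex.re (g.preGNS_norm_sq (g.toPreGNS c))
  rw [← h0, ← h0, ← mul_pow]
  exact pow_le_pow_left₀ (norm_nonneg _) h 2

/-- A positive functional that is small at `e`, with `0 ≤ e ≤ 1`, is small on the right ideal
generated by `e`. -/
theorem ContinuousLinearMap.norm_sq_apply_mul_le (f : A →L[ℂ] ℂ)
    (hf : ∀ a : A, 0 ≤ a → 0 ≤ f a) {e : A} (he : 0 ≤ e) (he' : e ≤ 1) (x : A) :
    ‖f (e * x)‖ ^ 2 ≤ (f e).re * (f (star x * x)).re := by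
  have hse : star e = e := he.isSelfAdjoint
  have hs1 : star (1 - e) = 1 - e := by rw [star_sub, star_one, hse]
  have h := f.norm_sq_apply_star_mul_le hf e x
  rw [hse] at h
  refine h.trans (mul_le_mul_of_nonneg_right ?_
    (Complex.nonneg_iff.1 (hf _ (star_mul_self_nonneg x))).1)
  have h1 : 0 ≤ star e * (1 - e) * e + star (1 - e) * e * (1 - e) :=
    add_nonneg (star_left_conjugate_nonneg (sub_nonneg.2 he') e)
      (star_left_conjugate_nonneg he (1 - e))
  rw [hse, hs1, show e * (1 - e) * e + (1 - e) * e * (1 - e) = e - e * e by noncomm_ring] at h1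
  have h2 := (Complex.nonneg_iff.1 (hf _ h1)).1
  rw [map_sub, Complex.sub_re] at h2
  linarith

/-- Uniqueness of the Jordan decomposition of a self-adjoint functional. -/
theorem ContinuousLinearMap.jordanDecomposition_unique (φ f g f' g' : A →L[ℂ] ℂ)
    (hsa : ∀ a : A, φ (star a) = starRingEnd ℂ (φ a))
    (hf : ∀ a : A, 0 ≤ a → 0 ≤ f a) (hg : ∀ a : A, 0 ≤ a → 0 ≤ g a)
    (hf' : ∀ a : A, 0 ≤ a → 0 ≤ f' a) (hg' : ∀ a : A, 0 ≤ a → 0 ≤ g' a)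
    (h : φ = f - g) (h' : φ = f' - g')
    (hn : (f 1).re + (g 1).re ≤ ‖φ‖) (hn' : (f' 1).re + (g' 1).re ≤ ‖φ‖) : f = f' := by
  ext x
  set C : ℝ := (f (star x * x)).re + (g (star x * x)).re + (f' (star x * x)).re +
    (g' (star x * x)).re with hC
  have nn {k : A →L[ℂ] ℂ} (hk : ∀ a : A, 0 ≤ a → 0 ≤ k a) {a : A} (ha : 0 ≤ a) : 0 ≤ (k a).re :=
    (Complex.nonneg_iff.1 (hk a ha)).1
  have hx := star_mul_self_nonneg x
  have f0 := nn hf hx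
  have g0 := nn hg hx
  have f0' := nn hf' hx
  have g0' := nn hg' hx
  have bound (ε : ℝ) (hε : 0 < ε) : ‖f x - f' x‖ ^ 2 ≤ ε * (16 * C) := by
    obtain ⟨a, ha, ha1, hφa⟩ := φ.exists_isSelfAdjoint_lt_re_apply hsa
      (show ‖φ‖ - 2 * ε < ‖φ‖ by linarith)
    have hle : algebraMap ℝ A ‖a‖ ≤ 1 := by
      simpa using algebraMap_mono A ha1
    have ha_le : 0 ≤ 1 - a := sub_nonneg.2 (ha.le_algebraMap_norm_self.trans hle)
    have ha_ge : 0 ≤ 1 + a := by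
      have := (neg_le_neg hle).trans ha.neg_algebraMap_norm_le_self
      simpa [add_comm] using sub_nonneg.2 this
    set e : A := (2⁻¹ : ℝ) • (1 + a) with he_def
    have hee : 1 - e = (2⁻¹ : ℝ) • (1 - a) := by rw [he_def]; module
    have he : 0 ≤ e := smul_nonneg (by norm_num) ha_ge
    have he1 : 0 ≤ 1 - e := hee ▸ smul_nonneg (by norm_num) ha_le
    have ae : a = e - (1 - e) := by rw [hee, he_def]; module
    have small {p q : A →L[ℂ] ℂ} (hp : ∀ a : A, 0 ≤ a → 0 ≤ p a)
        (hq : ∀ a : A, 0 ≤ a → 0 ≤ q a) (hpq : φ = p - q) (hpn : (p 1).re + (q 1).re ≤ ‖φ‖)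
        (hpC : (p (star x * x)).re ≤ C) (hqC : (q (star x * x)).re ≤ C) :
        ‖p ((1 - e) * x)‖ ≤ √(ε * C) ∧ ‖q (e * x)‖ ≤ √(ε * C) := by
      have e1 := nn hp he1
      have e2 := nn hq he
      have hs : (p (1 - e)).re + (q e).re ≤ ε := by
        rw [hpq, ae] at hφa
        rw [hpq] at hpn
        simp only [sub_apply, map_sub, Complex.sub_re] at hφa ⊢
        linarith
      refine ⟨Real.le_sqrt_of_sq_le ?_, Real.le_sqrt_of_sq_le ?_⟩
      · refine (p.norm_sq_apply_mul_le hp he1 (by simpa using he) x).trans ?_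
        exact mul_le_mul (by linarith) hpC (nn hp hx) hε.le
      · refine (q.norm_sq_apply_mul_le hq he (sub_nonneg.1 he1) x).trans ?_
        exact mul_le_mul (by linarith) hqC (nn hq hx) hε.le
    obtain ⟨b1, b2⟩ := small hf hg h hn (by linarith) (by linarith)
    obtain ⟨b3, b4⟩ := small hf' hg' h' hn' (by linarith) (by linarith)
    have hd : f x - f' x = f ((1 - e) * x) + g (e * x) - f' ((1 - e) * x) - g' (e * x) := by
      have := DFunLike.congr_fun (h.symm.trans h') (e * x)
      simp only [sub_apply, sub_mul, one_mul, map_sub] at this ⊢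
      linear_combination this
    have hb : ‖f x - f' x‖ ≤ 4 * √(ε * C) := by
      rw [hd]
      refine (norm_sub_le _ _).trans ?_
      have := norm_sub_le (f ((1 - e) * x) + g (e * x)) (f' ((1 - e) * x))
      have := norm_add_le (f ((1 - e) * x)) (g (e * x))
      linarith
    calc ‖f x - f' x‖ ^ 2 ≤ (4 * √(ε * C)) ^ 2 := pow_le_pow_left₀ (norm_nonneg _) hb 2
      _ = ε * (16 * C) := by
        rw [mul_pow, Real.sq_sqrt (mul_nonneg hε.le (by linarith))]
        ring
  have hz : ‖f x - f' x‖ ^ 2 ≤ 0 := by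
    refine le_of_forall_pos_le_add fun δ hδ ↦ ?_
    have hC0 : 0 < 16 * C + 1 := by linarith
    refine (bound (δ / (16 * C + 1)) (by positivity)).trans ?_
    rw [zero_add, div_mul_eq_mul_div, div_le_iff₀ hC0]
    nlinarith
  exact sub_eq_zero.1 (norm_eq_zero.1
    (pow_eq_zero_iff two_ne_zero |>.1 (hz.antisymm (sq_nonneg _))))

/-- The positive part of a tracial self-adjoint functional is tracial. -/
theorem ContinuousLinearMap.jordanDecomposition_tracial (φ f g : A →L[ℂ] ℂ)
    (hsa : ∀ a : A, φ (star a) = starRingEnd ℂ (φ a))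
    (htr : ∀ x y : A, φ (x * y) = φ (y * x))
    (hf : ∀ a : A, 0 ≤ a → 0 ≤ f a) (hg : ∀ a : A, 0 ≤ a → 0 ≤ g a)
    (h : φ = f - g) (hn : (f 1).re + (g 1).re ≤ ‖φ‖) (x y : A) : f (x * y) = f (y * x) := by
  have hx : x ∈ Submodule.span ℂ (unitary A : Set A) := by simp [CStarAlgebra.span_unitary]
  induction hx using Submodule.span_induction with
  | zero => simp
  | add x₁ x₂ _ _ h₁ h₂ => simp [add_mul, mul_add, h₁, h₂]
  | smul c x _ ih => simp [ih]
  | mem u hu =>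
    let T : A →L[ℂ] A := (ContinuousLinearMap.mul ℂ A u).comp
      ((ContinuousLinearMap.mul ℂ A).flip (star u))
    have hT (z : A) : T z = u * (z * star u) := rfl
    have hTpos (z : A) (hz : 0 ≤ z) : 0 ≤ T z := by
      rw [hT, ← mul_assoc]
      exact star_right_conjugate_nonneg hz u
    have hT1 : T 1 = 1 := by rw [hT, one_mul, Unitary.mul_star_self_of_mem hu]
    have hφT : φ = f.comp T - g.comp T := by
      ext z
      have : φ (T z) = φ z := by
        rw [hT, htr, mul_assoc, Unitary.star_mul_self_of_mem hu, mul_one]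
      rw [← this, h]
      rfl
    have key := φ.jordanDecomposition_unique f g (f.comp T) (g.comp T) hsa hf hg
      (fun z hz ↦ hf _ (hTpos z hz)) (fun z hz ↦ hg _ (hTpos z hz)) h hφT hn
      (by simpa [hT1] using hn)
    have := DFunLike.congr_fun key (y * u)
    rw [ContinuousLinearMap.comp_apply, hT, mul_assoc, Unitary.mul_star_self_of_mem hu,
      mul_one] at this
    exact this.symm

end JordanDecomposition



/-- If `φ` is a bounded self-adjoint functional on a C*-algebra with
`φ(a*a) = φ(aa*)` for all `a`, then both pieces of its Jordan decomposition
`φ = φ₊ − φ₋` (positive functionals with `‖φ‖ = ‖φ₊‖ + ‖φ₋‖`) are tracial. -/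
theorem stmt_12 {A : Type*} [CStarAlgebra A] [PartialOrder A] [StarOrderedRing A]
    (φ φp φm : A →L[ℂ] ℂ)
    (hsa : ∀ a : A, φ (star a) = starRingEnd ℂ (φ a))
    (htr : ∀ a : A, φ (star a * a) = φ (a * star a))
    (hφp : ∀ a : A, 0 ≤ a → 0 ≤ φp a)
    (hφm : ∀ a : A, 0 ≤ a → 0 ≤ φm a)
    (hdec : φ = φp - φm)
    (hnorm : ‖φ‖ = ‖φp‖ + ‖φm‖) :
    (∀ x y : A, φp (x * y) = φp (y * x)) ∧ (∀ x y : A, φm (x * y) = φm (y * x)) := by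

  have hone (k : A →L[ℂ] ℂ) : (k 1).re ≤ ‖k‖ := by
    obtain _ | _ := subsingleton_or_nontrivial A
    · simp [Subsingleton.elim (1 : A) 0]
    · exact (Complex.re_le_norm _).trans (by simpa using k.le_opNorm 1)
  have hn : (φp 1).re + (φm 1).re ≤ ‖φ‖ := hnorm ▸ add_le_add (hone φp) (hone φm)
  have htr' := φ.map_mul_comm_of_map_star_mul_self htr
  have hp := φ.jordanDecomposition_tracial φp φm hsa htr' hφp hφm hdec hn
  refine ⟨hp, fun x y ↦ ?_⟩
  have := htr' x y
  rw [hdec, sub_apply, sub_apply, hp x y] at this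
  exact sub_right_injective this
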